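/- arXiv:math/0703073 — 5 statements merged into one kernel-verified Lean document; each statement's English description precedes it below -/
import Mathlib

section
/- Let G be a finite group and let k ≥ 1 be a natural number. Then, as an equality of rational numbers, the number of k-tuples (a₁, …, a_k) ∈ G^k satisfying a₁² a₂² ⋯ a_k² = 1 equals |G|^{k-1} · ∑_{V} (ν(V)·d(V))^{2-k}, where the sum ranges over those V ∈ Irr(G) with ν(V) ≠ 0 and the exponent 2-k is an integer power (possibly negative). -/
open Module

namespace FrobeniusSchur

/-- A sum of ordered products over all tuples is a power of the sum. -/
theorem sum_prod_ofFn {A G : Type*} [Semiring A] [Fintype G] (f : G → A) (k : ℕ) :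
    ∑ t : Fin k → G, (List.ofFn fun i => f (t i)).prod = (∑ g, f g) ^ k := by
  induction k with
  | zero => simp
  | succ n ih =>
    rw [← (Fin.consEquiv fun _ => G).sum_comp, Fintype.sum_prod_type, pow_succ', ← ih,
      Finset.sum_mul_sum]
    simp [Fin.consEquiv, List.ofFn_succ]

/-- The trace of the swap composed with `f ⊗ f` is the trace of `f²`. -/
theorem trace_comm_comp_map {K V : Type*} [Field K] [AddCommGroup V] [Module K V]
    [FiniteDimensional K V] (f : V →ₗ[K] V) :
    LinearMap.trace K _ ((TensorProduct.comm K V V).toLinearMap ∘ₗ TensorProduct.map f f) =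
      LinearMap.trace K V (f * f) := by
  classical
  let b := finBasis K V
  rw [LinearMap.trace_eq_matrix_trace K (b.tensorProduct b),
    LinearMap.trace_eq_matrix_trace K b, LinearMap.toMatrix_mul]
  simp only [Matrix.trace, Matrix.diag, Matrix.mul_apply, Fintype.sum_prod_type]
  refine Finset.sum_congr rfl fun i _ => Finset.sum_congr rfl fun j _ => ?_
  simp [LinearMap.toMatrix_apply, Basis.tensorProduct_repr_tmul_apply, mul_comm]

section Representation

variable {G V : Type} [Group G] [Fintype G] [AddCommGroup V] [Module ℂ V]
  [FiniteDimensional ℂ V] (σ : Representation ℂ G V)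

/-- Schur's lemma, phrased through the norm of the character. -/
theorem eq_smul_id_of_commute
    (hσ : ∑ g, σ.character g * σ.character g⁻¹ = (Nat.card G : ℂ)) (T : V →ₗ[ℂ] V)
    (hT : ∀ g, σ g * T = T * σ g) : ∃ c : ℂ, T = c • LinearMap.id := by
  have hG : (Nat.card G : ℂ) ≠ 0 := by simp
  have := invertibleOfNonzero hG
  have h1 := (σ.linHom σ).card_inv_mul_sum_char_eq_finrank
  simp_rw [Representation.char_linHom, mul_comm (σ.character _⁻¹), hσ] at h1
  rw [inv_mul_cancel₀ hG] at h1
  have h2 : finrank ℂ (σ.linHom σ).invariants = 1 := by exact_mod_cast h1.symm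
  have hmem : ∀ S : V →ₗ[ℂ] V, (∀ g, σ g * S = S * σ g) → S ∈ (σ.linHom σ).invariants := by
    intro S hS g
    ext v
    have h3 := LinearMap.congr_fun (hS g) (σ g⁻¹ v)
    simpa using h3
  by_cases hid : (LinearMap.id : V →ₗ[ℂ] V) = 0
  · refine ⟨0, ?_⟩
    ext v
    have := LinearMap.congr_fun hid (T v)
    simpa using this
  · obtain ⟨c, hc⟩ := (finrank_eq_one_iff_of_nonzero'
      (⟨LinearMap.id, hmem _ fun _ => rfl⟩ : (σ.linHom σ).invariants)
      (fun h => hid (congrArg Subtype.val h))).1 h2 ⟨T, hmem T hT⟩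
    exact ⟨c, (congrArg Subtype.val hc).symm⟩

/-- A class function acts on a representation with irreducible character by a scalar. -/
theorem exists_sum_smul_eq_smul_id
    (hσ : ∑ g, σ.character g * σ.character g⁻¹ = (Nat.card G : ℂ)) (f : G → ℂ)
    (hf : ∀ g h, f (h * g * h⁻¹) = f g) : ∃ c : ℂ, ∑ g, f g • σ g = c • LinearMap.id := by
  refine eq_smul_id_of_commute σ hσ _ fun h => ?_
  rw [Finset.mul_sum, Finset.sum_mul, ← (MulAut.conj h).toEquiv.sum_comp (fun g => f g • σ g * σ h)]
  refine Finset.sum_congr rfl fun g _ => ?_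
  simp [hf, ← map_mul]

/-- The sum of all `σ (g ^ 2)` acts on a representation with irreducible character by a scalar. -/
theorem exists_sum_sq_eq_smul_id
    (hσ : ∑ g, σ.character g * σ.character g⁻¹ = (Nat.card G : ℂ)) :
    ∃ c : ℂ, ∑ g, σ (g ^ 2) = c • LinearMap.id := by
  refine eq_smul_id_of_commute σ hσ _ fun h => ?_
  rw [Finset.mul_sum, Finset.sum_mul,
    ← (MulAut.conj h).toEquiv.sum_comp (fun g => σ (g ^ 2) * σ h)]
  refine Finset.sum_congr rfl fun g _ => ?_
  simp [← map_mul, pow_two, mul_assoc]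

/-- If `σ ⊗ σ` has at most a line of invariants then the Frobenius–Schur indicator of `σ`
is `0` or squares to `1`. -/
theorem indicator_eq_zero_or_sq_eq_one (h : finrank ℂ (σ.tprod σ).invariants ≤ 1) :
    (Fintype.card G : ℂ)⁻¹ * ∑ g, σ.character (g ^ 2) = 0 ∨
      ((Fintype.card G : ℂ)⁻¹ * ∑ g, σ.character (g ^ 2)) ^ 2 = 1 := by
  have hG : (Fintype.card G : ℂ) ≠ 0 := by simp
  have := invertibleOfNonzero hG
  set τ := (TensorProduct.comm ℂ V V).toLinearMap with hτ
  set P := (σ.tprod σ).averageMap with hP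
  have hPsum : P = (Fintype.card G : ℂ)⁻¹ • ∑ g, TensorProduct.map (σ g) (σ g) := by
    simp [hP, GroupAlgebra.average, map_sum]
  have htr : LinearMap.trace ℂ _ (τ ∘ₗ P) =
      (Fintype.card G : ℂ)⁻¹ * ∑ g, σ.character (g ^ 2) := by
    rw [hPsum, LinearMap.comp_smul, map_smul, smul_eq_mul, ← Module.End.mul_eq_comp, Finset.mul_sum,
      map_sum]
    congr 1
    refine Finset.sum_congr rfl fun g _ => ?_
    rw [Module.End.mul_eq_comp, trace_comm_comp_map, Representation.character, pow_two, map_mul σ]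
  have hτinv : ∀ x ∈ (σ.tprod σ).invariants, τ x ∈ (σ.tprod σ).invariants := by
    intro x hx g
    have h1 : ∀ y, σ.tprod σ g (τ y) = τ (σ.tprod σ g y) := fun y => by
      induction y with
      | zero => simp
      | tmul a b => simp [hτ]
      | add a b ha hb => simp only [map_add, ha, hb]
    rw [h1, hx g]
  have hrange : ∀ x, (τ ∘ₗ P) x ∈ (σ.tprod σ).invariants := fun x =>
    hτinv _ ((σ.tprod σ).averageMap_invariant x)
  rw [← htr, ← LinearMap.trace_restrict_eq_of_forall_mem _ _ hrange]
  set R := (τ ∘ₗ P).restrict fun x (_ : x ∈ (σ.tprod σ).invariants) => hrange x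
  have hRR : ∀ x, R (R x) = x := by
    intro x
    have hval : ∀ y, (R y : TensorProduct ℂ V V) = τ y := fun y => by
      change τ (P y) = τ y
      rw [hP, (σ.tprod σ).averageMap_id _ y.2]
    ext
    rw [hval, hval]
    simp [hτ]
  rcases Nat.le_one_iff_eq_zero_or_eq_one.1 h with h0 | h1
  · left
    have : Subsingleton (σ.tprod σ).invariants := finrank_zero_iff.1 h0
    rw [Subsingleton.elim R 0, map_zero]
  · right
    obtain ⟨v, hv, hspan⟩ := finrank_eq_one_iff'.1 h1
    obtain ⟨c, hc⟩ := hspan (R v)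
    have hRc : R = c • LinearMap.id := by
      ext1 w
      obtain ⟨a, rfl⟩ := hspan w
      rw [map_smul, ← hc, LinearMap.smul_apply, LinearMap.id_apply, smul_comm]
    have h2 := hRR v
    rw [← hc, map_smul, ← hc, smul_smul] at h2
    have h3 : c * c = 1 := by
      refine smul_left_injective ℂ (fun h => hv (Subtype.ext h) : (v : TensorProduct ℂ V V) ≠ 0) ?_
      simpa using congrArg Subtype.val h2
    rw [hRc, map_smul, LinearMap.trace_id, h1]
    simpa [pow_two] using h3

end Representation

section FDRep

variable {G : Type} [Group G] [Fintype G]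

/-- The tensor square of an irreducible representation has at most a line of invariants. -/
theorem finrank_invariants_tprod_self_le_one (V : FDRep ℂ G) (hV : CategoryTheory.Simple V) :
    finrank ℂ (Representation.tprod V.ρ V.ρ).invariants ≤ 1 := by
  classical
  have hG : (Nat.card G : ℂ) ≠ 0 := by simp
  have := invertibleOfNonzero hG
  let D : FDRep ℂ G := FDRep.of (Representation.dual V.ρ)
  have hD : CategoryTheory.Simple D := by
    rw [FDRep.simple_iff_char_is_norm_one]
    simp only [D, FDRep.char_dual, inv_inv]
    simpa [mul_comm] using V.simple_iff_char_is_norm_one.1 hV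
  have h1 := FDRep.char_orthonormal V D
  have h2 := (Representation.tprod V.ρ V.ρ).card_inv_mul_sum_char_eq_finrank
  rw [Representation.char_tensor] at h2
  simp only [D, FDRep.char_dual, inv_inv] at h1
  have h3 : ((finrank ℂ (Representation.tprod V.ρ V.ρ).invariants : ℕ) : ℂ) =
      ((if Nonempty (V ≅ D) then 1 else 0 : ℕ) : ℂ) := by
    rw [← h2, Nat.cast_ite, Nat.cast_one, Nat.cast_zero]
    exact h1
  rw [Nat.cast_inj] at h3
  rw [h3]
  split_ifs <;> simp

/-- A class function orthogonal to an irreducible character acts as zero on the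
representation. -/
theorem sum_smul_eq_zero_of_orthogonal {W : Type} [AddCommGroup W] [Module ℂ W]
    [FiniteDimensional ℂ W] (σ : Representation ℂ G W)
    (hσ : ∑ g, σ.character g * σ.character g⁻¹ = (Nat.card G : ℂ)) (f : G → ℂ)
    (hf : ∀ g h, f (h * g * h⁻¹) = f g) (horth : ∑ g, f g * σ.character g = 0) :
    ∑ g, f g • σ g = 0 := by
  obtain ⟨c, hc⟩ := exists_sum_smul_eq_smul_id σ hσ f hf
  have h2 := congrArg (LinearMap.trace ℂ W) hc
  rw [map_sum, map_smul, LinearMap.trace_id] at h2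
  simp only [map_smul, smul_eq_mul] at h2
  have h3 : c * (finrank ℂ W : ℂ) = 0 := h2.symm.trans horth
  rw [hc]
  rcases mul_eq_zero.1 h3 with h4 | h4
  · rw [h4, zero_smul]
  · have := finrank_zero_iff.1 (Nat.cast_eq_zero.1 h4)
    exact Subsingleton.elim _ _

/-- The algebra action of the representation attached to a module is scalar multiplication. -/
theorem asAlgebraHom_ofModule' {G M : Type} [Group G] [AddCommGroup M] [Module ℂ M]
    [Module (MonoidAlgebra ℂ G) M] [IsScalarTower ℂ (MonoidAlgebra ℂ G) M]
    (r : MonoidAlgebra ℂ G) (x : M) :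
    (Representation.ofModule' (k := ℂ) (G := G) M).asAlgebraHom r x = r • x := by
  simp [Representation.asAlgebraHom, Representation.ofModule']

/-- A simple module over the group algebra is an irreducible representation. -/
theorem isIrreducible_ofModule' {G M : Type} [Group G] [AddCommGroup M] [Module ℂ M]
    [Module (MonoidAlgebra ℂ G) M] [IsScalarTower ℂ (MonoidAlgebra ℂ G) M]
    [IsSimpleModule (MonoidAlgebra ℂ G) M] :
    (Representation.ofModule' (k := ℂ) (G := G) M).IsIrreducible := by
  rw [Representation.irreducible_iff_isSimpleModule_asModule]
  let e : (Representation.ofModule' (k := ℂ) (G := G) M).asModule ≃ₗ[MonoidAlgebra ℂ G] M :=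
    { (Representation.ofModule' (k := ℂ) (G := G) M).asModuleEquiv.toAddEquiv with
      map_smul' := fun r x => asAlgebraHom_ofModule' r _ }
  exact IsSimpleModule.congr e

/-- A class function orthogonal to every irreducible character vanishes. -/
theorem eq_zero_of_orthogonal (f : G → ℂ) (hf : ∀ g h, f (h * g * h⁻¹) = f g)
    (horth : ∀ W : FDRep ℂ G, CategoryTheory.Simple W → ∑ g, f g * W.character g = 0) :
    f = 0 := by
  classical
  have hG : (Nat.card G : ℂ) ≠ 0 := by simp
  have := invertibleOfNonzero hG
  let z : MonoidAlgebra ℂ G := ∑ g, MonoidAlgebra.single g (f g)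
  have hsimple : ∀ S : Submodule (MonoidAlgebra ℂ G) (MonoidAlgebra ℂ G),
      IsSimpleModule (MonoidAlgebra ℂ G) S → ∀ x ∈ S, z * x = 0 := by
    intro S hS x hx
    let σ := Representation.ofModule' (k := ℂ) (G := G) S
    have hirr : σ.IsIrreducible := isIrreducible_ofModule'
    have hfin : Module.Finite ℂ S := Module.Finite.trans (MonoidAlgebra ℂ G) S
    have hnorm : ∑ g, σ.character g * σ.character g⁻¹ = (Nat.card G : ℂ) := by
      have h1 := Representation.char_orthonormal σ σ
      rw [if_pos ⟨Representation.Equiv.refl σ⟩, inv_mul_eq_one₀ hG] at h1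
      exact h1.symm
    have hW : CategoryTheory.Simple (FDRep.of σ) := by
      rw [FDRep.simple_iff_char_is_norm_one]
      exact hnorm
    have hz : σ.asAlgebraHom z = 0 := by
      rw [← sum_smul_eq_zero_of_orthogonal σ hnorm f hf (horth _ hW)]
      simp [z, map_sum, Representation.asAlgebraHom_single]
    have h5 := LinearMap.congr_fun hz ⟨x, hx⟩
    rw [asAlgebraHom_ofModule'] at h5
    exact congrArg Subtype.val h5
  have hker : (1 : MonoidAlgebra ℂ G) ∈
      sSup {S : Submodule (MonoidAlgebra ℂ G) (MonoidAlgebra ℂ G) |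
        IsSimpleModule (MonoidAlgebra ℂ G) S} := by
    rw [IsSemisimpleModule.sSup_simples_eq_top]
    trivial
  have hz1 : z * 1 = 0 := by
    rw [sSup_eq_iSup'] at hker
    exact Submodule.iSup_induction _ (motive := fun x => z * x = 0) hker
      (fun S x hx => hsimple S.1 S.2 x hx) (mul_zero z)
      fun x y hx hy => by rw [mul_add, hx, hy, add_zero]
  ext g
  rw [mul_one] at hz1
  have h6 := congrArg (fun a : MonoidAlgebra ℂ G => a.coeff g) hz1
  simpa [z, Finsupp.single_apply] using h6

/-- Second orthogonality against the identity: the character of the regular representation. -/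
theorem sum_finrank_mul_character (ι : Type) [Fintype ι] (V : ι → FDRep ℂ G)
    (hsimple : ∀ i, CategoryTheory.Simple (V i))
    (hdistinct : ∀ i j : ι, Nonempty (V i ≅ V j) → i = j)
    (hcomplete : ∀ W : FDRep ℂ G, CategoryTheory.Simple W → ∃ i, Nonempty (W ≅ V i))
    [DecidableEq G] (g : G) :
    ∑ i, (finrank ℂ (V i) : ℂ) * (V i).character g =
      if g = 1 then (Fintype.card G : ℂ) else 0 := by
  classical
  have hG : (Nat.card G : ℂ) ≠ 0 := by simp
  have := invertibleOfNonzero hG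
  let f : G → ℂ := fun g => ∑ i, (finrank ℂ (V i) : ℂ) * (V i).character g⁻¹ -
    if g = 1 then (Fintype.card G : ℂ) else 0
  have hf : f = 0 := by
    refine eq_zero_of_orthogonal f (fun g h => ?_) fun W hW => ?_
    · have h1 : (h * g * h⁻¹)⁻¹ = h * g⁻¹ * h⁻¹ := by group
      simp only [f, h1, FDRep.char_conj, conj_eq_one_iff]
    · obtain ⟨j, ⟨e⟩⟩ := hcomplete W hW
      have horth : ∀ i, ∑ g, (V i).character g⁻¹ * (V j).character g =
          if i = j then (Nat.card G : ℂ) else 0 := by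
        intro i
        have h2 := FDRep.char_orthonormal (V j) (V i)
        have h3 : Nonempty (V j ≅ V i) ↔ i = j :=
          ⟨fun h => (hdistinct j i h).symm, fun h => h ▸ ⟨CategoryTheory.Iso.refl _⟩⟩
        rw [inv_mul_eq_iff_eq_mul₀ hG] at h2
        simp only [h3, mul_ite, mul_one, mul_zero] at h2
        simpa only [mul_comm] using h2
      rw [FDRep.char_iso e]
      simp only [f, sub_mul, Finset.sum_sub_distrib, Finset.sum_mul, mul_assoc]
      rw [Finset.sum_comm]
      simp only [← Finset.mul_sum, horth]
      simp [mul_comm]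
  have h4 := congrFun hf g⁻¹
  simpa [f, sub_eq_zero] using h4

/-- The character sum over all values of the word `a₁² ⋯ a_k²`. -/
theorem finrank_mul_sum_character_prod_sq (V : FDRep ℂ G) (hV : CategoryTheory.Simple V)
    (ν : ℂ) (hν : ν = (Fintype.card G : ℂ)⁻¹ * ∑ g : G, V.character (g ^ 2)) (k : ℕ)
    (hd : (finrank ℂ V : ℂ) ≠ 0) :
    ∑ t : Fin k → G, V.character (List.ofFn fun i => t i ^ 2).prod =
      ((Fintype.card G : ℂ) * ν / finrank ℂ V) ^ k * finrank ℂ V := by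
  have hG : (Fintype.card G : ℂ) ≠ 0 := by simp
  obtain ⟨c, hc⟩ := exists_sum_sq_eq_smul_id V.ρ (V.simple_iff_char_is_norm_one.1 hV)
  have h1 : ∑ g : G, V.character (g ^ 2) = c * finrank ℂ V := by
    have h2 := congrArg (LinearMap.trace ℂ V) hc
    rw [map_sum, map_smul, LinearMap.trace_id, smul_eq_mul] at h2
    exact h2
  have hcν : (Fintype.card G : ℂ) * ν / finrank ℂ V = c := by
    rw [hν, h1]
    field_simp
  have h3 := congrArg (LinearMap.trace ℂ V) (sum_prod_ofFn (fun g : G => V.ρ (g ^ 2)) k)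
  rw [hc, map_sum] at h3
  have h4 : (c • (LinearMap.id : V →ₗ[ℂ] V)) ^ k = c ^ k • LinearMap.id := by
    rw [smul_pow]
    exact congrArg _ (one_pow k)
  rw [h4, map_smul, LinearMap.trace_id, smul_eq_mul] at h3
  rw [hcν, ← h3]
  refine Finset.sum_congr rfl fun t _ => ?_
  rw [FDRep.character, map_list_prod, List.map_ofFn]
  rfl

/-- An irreducible representation is nonzero. -/
theorem finrank_ne_zero_of_simple (V : FDRep ℂ G) (hV : CategoryTheory.Simple V) :
    (finrank ℂ V : ℂ) ≠ 0 := by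
  intro h
  have h0 : Subsingleton V := finrank_zero_iff.1 (Nat.cast_eq_zero.1 h)
  have h1 := V.simple_iff_char_is_norm_one.1 hV
  have h2 : ∀ g, V.character g = 0 := fun g => by
    rw [FDRep.character, Subsingleton.elim (V.ρ g) 0, map_zero]
  simp only [h2, zero_mul, Finset.sum_const_zero] at h1
  exact Nat.cast_ne_zero.2 Nat.card_pos.ne' h1.symm

end FDRep

end FrobeniusSchur


open scoped Classical in
/-- **Frobenius–Schur formula** (nonorientable case).  Let `G` be a finite group and
`k ≥ 1`.  If `V : ι → FDRep ℂ G` is a complete set of representatives of the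
isomorphism classes of irreducible complex representations of `G`, and
`ν i = |G|⁻¹ ∑_g χ_{V i}(g²)` is the Frobenius–Schur indicator, then the number of
`k`-tuples `(a₁, …, a_k)` in `G` with `a₁² ⋯ a_k² = 1` equals
`|G|^(k-1) · ∑_{ν(V) ≠ 0} (ν(V)·d(V))^(2-k)`. -/
theorem frobenius_schur_nonorientable (G : Type) [Group G] [Fintype G] (k : ℕ) (hk : 1 ≤ k)
    (ι : Type) [Fintype ι] (V : ι → FDRep ℂ G)
    (hsimple : ∀ i, CategoryTheory.Simple (V i))
    (hdistinct : ∀ i j : ι, Nonempty (V i ≅ V j) → i = j)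
    (hcomplete : ∀ W : FDRep ℂ G, CategoryTheory.Simple W → ∃ i, Nonempty (W ≅ V i))
    (ν : ι → ℂ)
    (hν : ∀ i, ν i = (Fintype.card G : ℂ)⁻¹ * ∑ g : G, (V i).character (g ^ 2)) :
    (Nat.card {t : Fin k → G // (List.ofFn fun i => (t i) ^ 2).prod = 1} : ℂ) =
      (Fintype.card G : ℂ) ^ ((k : ℤ) - 1) *
        ∑ i ∈ Finset.univ.filter (fun i => ν i ≠ 0),
          (ν i * (Module.finrank ℂ (V i) : ℂ)) ^ (2 - (k : ℤ)) := by
  have hG : (Fintype.card G : ℂ) ≠ 0 := by simp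
  have hd : ∀ i, (Module.finrank ℂ (V i) : ℂ) ≠ 0 := fun i =>
    FrobeniusSchur.finrank_ne_zero_of_simple (V i) (hsimple i)
  have hν01 : ∀ i, ν i = 0 ∨ ν i ^ 2 = 1 := fun i => by
    rw [hν i]
    exact FrobeniusSchur.indicator_eq_zero_or_sq_eq_one (V i).ρ
      (FrobeniusSchur.finrank_invariants_tprod_self_le_one (V i) (hsimple i))
  have hcount : (Fintype.card G : ℂ) *
      (Nat.card {t : Fin k → G // (List.ofFn fun i => (t i) ^ 2).prod = 1} : ℂ) =
      ∑ i, (Module.finrank ℂ (V i) : ℂ) *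
        (((Fintype.card G : ℂ) * ν i / Module.finrank ℂ (V i)) ^ k *
          Module.finrank ℂ (V i)) := by
    simp_rw [← fun i => FrobeniusSchur.finrank_mul_sum_character_prod_sq (V i) (hsimple i) (ν i)
      (hν i) k (hd i), Finset.mul_sum]
    rw [Finset.sum_comm]
    simp_rw [FrobeniusSchur.sum_finrank_mul_character ι V hsimple hdistinct hcomplete]
    rw [Nat.card_eq_fintype_card, Fintype.card_subtype, Finset.sum_ite]
    simp [mul_comm]
  apply mul_left_cancel₀ hG
  rw [hcount, Finset.sum_filter, Finset.mul_sum, Finset.mul_sum]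
  refine Finset.sum_congr rfl fun i _ => ?_
  rcases hν01 i with h0 | h1
  · simp [h0, Nat.one_le_iff_ne_zero.1 hk]
  · have hne : ν i ≠ 0 := fun h => by simp [h] at h1
    have hνk : ν i ^ (2 - (k : ℤ)) = ν i ^ k := by
      rw [zpow_sub₀ hne, zpow_natCast, div_eq_iff (pow_ne_zero k hne), ← mul_pow, ← pow_two, h1,
        one_pow]
      exact_mod_cast h1
    have hdk := hd i
    rw [if_pos hne, mul_zpow, hνk, zpow_sub₀ hG, zpow_sub₀ hdk, zpow_natCast, zpow_natCast,
      zpow_one, zpow_ofNat, div_pow, mul_pow]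
    field_simp
end

section
/- Let G be a finite group. The number of elements a ∈ G with a² = 1 equals ∑_{V ∈ Irr(G)} ν(V)·d(V). -/
open scoped MonoidAlgebra

namespace Representation

section

variable {k G V : Type*} [Field k] [IsAlgClosed k] [CharZero k] [Group G] [Fintype G]
  [AddCommGroup V] [Module k V] [FiniteDimensional k V]

/-- By Schur's lemma, a class function orthogonal to an irreducible character acts as zero. -/
theorem sum_smul_eq_zero_of_sum_mul_character_eq_zero (ρ : Representation k G V) [IsIrreducible ρ]
    (f : G → k) (hf : ∀ g h, f (h * g * h⁻¹) = f g)
    (h0 : ∑ g, f g * ρ.character g = 0) : ∑ g, f g • ρ g = 0 := by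
  have hcomm (h : G) : (∑ g, f g • ρ g) ∘ₗ ρ h = ρ h ∘ₗ (∑ g, f g • ρ g) := by
    change (∑ g, f g • ρ g) * ρ h = ρ h * (∑ g, f g • ρ g)
    rw [Finset.sum_mul, Finset.mul_sum, ← (MulAut.conj h).toEquiv.sum_comp]
    refine Finset.sum_congr rfl fun g _ ↦ ?_
    simp [hf, ← map_mul]
  obtain ⟨c, hc⟩ := (IsIrreducible.algebraMap_intertwiningMap_bijective_of_isAlgClosed
    (ρ := ρ)).2 ⟨∑ g, f g • ρ g, fun h ↦ hcomm h⟩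
  have hc' : ∑ g, f g • ρ g = c • (1 : V →ₗ[k] V) :=
    (congrArg IntertwiningMap.toLinearMap hc).symm
  have : Nontrivial V := by
    by_contra h
    rw [not_nontrivial_iff_subsingleton] at h
    exact bot_ne_top (α := Subrepresentation ρ)
      (Subrepresentation.toSubmodule_injective (Subsingleton.elim _ _))
  have htr := congrArg (LinearMap.trace k V) hc'
  simp only [map_sum, map_smul, LinearMap.trace_one, smul_eq_mul] at htr
  change ∑ g, f g * ρ.character g = _ at htr
  rw [h0, eq_comm, mul_eq_zero] at htr
  have hd : (Module.finrank k V : k) ≠ 0 := by exact_mod_cast Module.finrank_pos.ne'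
  rw [hc', htr.resolve_right hd, zero_smul]

end

section

variable {k G M : Type*} [CommRing k] [Group G] [AddCommGroup M] [Module k M] [Module k[G] M]
  [IsScalarTower k k[G] M]

theorem asAlgebraHom_ofModule'_apply (r : k[G]) (x : M) :
    (ofModule' (k := k) (G := G) M).asAlgebraHom r x = r • x := by
  simp [ofModule', asAlgebraHom]

variable (k G M) in
/-- A `k[G]`-module is isomorphic to the module attached to its representation. -/
noncomputable def asModuleOfModule'Equiv :
    (ofModule' (k := k) (G := G) M).asModule ≃ₗ[k[G]] M where
  __ := (ofModule' (k := k) (G := G) M).asModuleEquiv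
  map_smul' r x :=
    (asModuleEquiv_map_smul _ r x).trans (asAlgebraHom_ofModule'_apply r _)

end

section

variable {k G : Type} [Field k] [IsAlgClosed k] [CharZero k] [Group G] [Fintype G]
  (f : G → k) (hf : ∀ g h, f (h * g * h⁻¹) = f g)
  (h0 : ∀ (V : Type) [AddCommGroup V] [Module k V] [FiniteDimensional k V]
    (ρ : Representation k G V) [IsIrreducible ρ], ∑ g, f g * ρ.character g = 0)

include hf h0

/-- A class function orthogonal to all irreducible characters acts as zero on simple modules. -/
theorem sum_single_smul_eq_zero (M : Type) [AddCommGroup M] [Module k M] [Module k[G] M]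
    [IsScalarTower k k[G] M] [IsSimpleModule k[G] M] (x : M) :
    (∑ g, MonoidAlgebra.single g (f g) : k[G]) • x = 0 := by
  have : IsIrreducible (ofModule' (k := k) (G := G) M) := by
    rw [irreducible_iff_isSimpleModule_asModule]
    exact (asModuleOfModule'Equiv k G M).isSimpleModule_iff.2 inferInstance
  have : Module.Finite k M := .trans k[G] M
  have h := sum_smul_eq_zero_of_sum_mul_character_eq_zero _ f hf
    (h0 _ (ofModule' (k := k) (G := G) M))
  rw [← asAlgebraHom_ofModule'_apply]
  simp only [map_sum, asAlgebraHom_single, h, LinearMap.zero_apply]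

/-- A class function orthogonal to all irreducible characters vanishes. -/
theorem eq_zero_of_forall_sum_mul_character_eq_zero : f = 0 := by
  have : NeZero (Nat.card G : k) := ⟨by exact_mod_cast Nat.card_pos.ne'⟩
  have hz (x : k[G]) : (∑ g, MonoidAlgebra.single g (f g) : k[G]) • x = 0 := by
    have hx : x ∈ ⨆ m : {m : Submodule k[G] k[G] | IsSimpleModule k[G] m},
        (m : Submodule k[G] k[G]) := by
      rw [← sSup_eq_iSup', IsSemisimpleModule.sSup_simples_eq_top]
      trivial
    induction hx using Submodule.iSup_induction' with
    | zero => rw [smul_zero]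
    | add x y _ _ hx hy => rw [smul_add, hx, hy, add_zero]
    | mem m x hx =>
      have : IsSimpleModule k[G] m.1 := m.2
      exact congrArg Subtype.val (sum_single_smul_eq_zero f hf h0 m.1 ⟨x, hx⟩)
  funext g
  classical
  simpa [Finsupp.single_apply] using congrArg (fun z : k[G] ↦ z.coeff g) (hz 1)

end

end Representation

/-- Irreducible representations of a finite group give simple objects of `FDRep`. -/
theorem FDRep.simple_of_isIrreducible {k G V : Type} [Field k] [IsAlgClosed k] [CharZero k]
    [Group G] [Fintype G] [AddCommGroup V] [Module k V] [FiniteDimensional k V]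
    (ρ : Representation k G V) [ρ.IsIrreducible] : CategoryTheory.Simple (FDRep.of ρ) := by
  have : Invertible (Nat.card G : k) :=
    invertibleOfNonzero (by exact_mod_cast Nat.card_pos.ne')
  have h := Representation.char_orthonormal ρ ρ
  rw [if_pos ⟨.refl ρ⟩, inv_mul_eq_one₀ (Invertible.ne_zero _)] at h
  rw [FDRep.simple_iff_char_is_norm_one]
  exact h.symm

/-- The irreducible characters weighted by their degrees sum to the regular character. -/
theorem FDRep.sum_finrank_mul_character {G ι : Type} [Group G] [Fintype G] [DecidableEq G]
    [Fintype ι] (V : ι → FDRep ℂ G)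
    (hsimple : ∀ i, CategoryTheory.Simple (V i))
    (hdistinct : ∀ i j : ι, Nonempty (V i ≅ V j) → i = j)
    (hcomplete : ∀ W : FDRep ℂ G, CategoryTheory.Simple W → ∃ i, Nonempty (W ≅ V i)) (g : G) :
    ∑ i, (Module.finrank ℂ (V i) : ℂ) * (V i).character g =
      if g = 1 then (Fintype.card G : ℂ) else 0 := by
  classical
  have : Invertible (Nat.card G : ℂ) :=
    invertibleOfNonzero (by exact_mod_cast Nat.card_pos.ne')
  have horth (i j : ι) : ∑ g, (V i).character g * (V j).character g⁻¹ =
      if i = j then (Nat.card G : ℂ) else 0 := by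
    have := hsimple i
    have := hsimple j
    have h := FDRep.char_orthonormal (V i) (V j)
    rw [inv_mul_eq_iff_eq_mul₀ (Invertible.ne_zero _)] at h
    rw [h]
    by_cases hij : i = j
    · subst hij
      simp [show Nonempty (V i ≅ V i) from ⟨.refl _⟩]
    · simp [hij, show ¬ Nonempty (V i ≅ V j) from fun h ↦ hij (hdistinct i j h)]
  have hzero := Representation.eq_zero_of_forall_sum_mul_character_eq_zero
    (fun g : G ↦ ∑ i, (Module.finrank ℂ (V i) : ℂ) * (V i).character g⁻¹ -
      if g = 1 then (Fintype.card G : ℂ) else 0) ?_ ?_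
  · have h := congrFun hzero g⁻¹
    simpa [sub_eq_zero] using h
  · intro g h
    have hc (i : ι) : (V i).character (h * g * h⁻¹)⁻¹ = (V i).character g⁻¹ := by
      rw [← FDRep.char_conj (V i) g⁻¹ h]
      simp [mul_assoc]
    simp only [hc, conj_eq_one_iff]
  · intro W _ _ _ ρ _
    obtain ⟨j, ⟨e⟩⟩ := hcomplete (FDRep.of ρ) (FDRep.simple_of_isIrreducible ρ)
    have hχ : ρ.character = (V j).character := FDRep.char_iso e
    simp only [sub_mul, Finset.sum_sub_distrib, Finset.sum_mul, hχ]
    rw [Finset.sum_comm]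
    simp only [mul_assoc, ← Finset.mul_sum, mul_comm ((V _).character _⁻¹), horth]
    simp [mul_comm]

/-- The number of elements `a ∈ G` with `a² = 1` equals the sum over the irreducible
complex representations `V` of `G` of `ν(V)·d(V)`, where
`ν(V) = |G|⁻¹ ∑_g χ_V(g²)` is the Frobenius–Schur indicator. -/
theorem sum_fs_indicator_mul_dim (G : Type) [Group G] [Fintype G]
    (ι : Type) [Fintype ι] (V : ι → FDRep ℂ G)
    (hsimple : ∀ i, CategoryTheory.Simple (V i))
    (hdistinct : ∀ i j : ι, Nonempty (V i ≅ V j) → i = j)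
    (hcomplete : ∀ W : FDRep ℂ G, CategoryTheory.Simple W → ∃ i, Nonempty (W ≅ V i))
    (ν : ι → ℂ)
    (hν : ∀ i, ν i = (Fintype.card G : ℂ)⁻¹ * ∑ g : G, (V i).character (g ^ 2)) :
    (Nat.card {a : G // a ^ 2 = 1} : ℂ) =
      ∑ i : ι, ν i * (Module.finrank ℂ (V i) : ℂ) := by
  classical
  have hcard : (Fintype.card G : ℂ) ≠ 0 := by exact_mod_cast Fintype.card_ne_zero
  calc (Nat.card {a : G // a ^ 2 = 1} : ℂ)
      = (Fintype.card G : ℂ)⁻¹ * ∑ g : G, if g ^ 2 = 1 then (Fintype.card G : ℂ) else 0 := by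
        rw [Nat.card_eq_fintype_card, Fintype.card_subtype, ← Finset.sum_filter,
          Finset.sum_const, nsmul_eq_mul]
        field_simp
    _ = ∑ i : ι, ν i * (Module.finrank ℂ (V i) : ℂ) := by
        simp_rw [hν, ← FDRep.sum_finrank_mul_character V hsimple hdistinct hcomplete]
        rw [Finset.sum_comm, Finset.mul_sum]
        refine Finset.sum_congr rfl fun i _ ↦ ?_
        rw [← Finset.mul_sum]
        ring
end

section
/- Let G be a finite group. The number of pairs (a, b) ∈ G² with a² b² = 1 equals |G| times the number of V ∈ Irr(G) with ν(V) ≠ 0, i.e. |G| times the number of isomorphism classes of self-dual irreducible complex representations of G. -/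
open Module TensorProduct MonoidAlgebra

/-- The trace of `A ⊗ B` followed by the swap of tensor factors is the trace of `A ∘ B`. -/
theorem LinearMap.trace_comm_comp_map {k V : Type*} [Field k] [AddCommGroup V] [Module k V]
    [FiniteDimensional k V] (A B : V →ₗ[k] V) :
    LinearMap.trace k (V ⊗[k] V)
        ((TensorProduct.comm k V V).toLinearMap ∘ₗ TensorProduct.map A B) =
      LinearMap.trace k V (A ∘ₗ B) := by
  let b := Module.finBasis k V
  rw [LinearMap.trace_eq_matrix_trace k (b.tensorProduct b), LinearMap.trace_eq_matrix_trace k b,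
    LinearMap.toMatrix_comp b b b]
  simp only [Matrix.trace, Matrix.diag_apply, Matrix.mul_apply, LinearMap.toMatrix_apply,
    Fintype.sum_prod_type, Basis.tensorProduct_apply, LinearMap.comp_apply, LinearEquiv.coe_coe,
    TensorProduct.map_tmul, TensorProduct.comm_tmul, Basis.tensorProduct_repr_tmul_apply,
    smul_eq_mul]
  exact Finset.sum_comm

/-- A projection `P` of rank at most one commuting with an involution `τ` satisfies
`tr (τ P) ^ 2 = rank P`. -/
theorem LinearMap.IsProj.trace_comp_sq {k V : Type*} [Field k] [AddCommGroup V] [Module k V]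
    [FiniteDimensional k V] {P : V →ₗ[k] V} {I : Submodule k V} (hP : LinearMap.IsProj I P)
    (hI : finrank k I ≤ 1) (τ : V →ₗ[k] V) (hτ : τ ∘ₗ τ = LinearMap.id)
    (hc : τ ∘ₗ P = P ∘ₗ τ) :
    (LinearMap.trace k V (τ ∘ₗ P)) ^ 2 = finrank k I := by
  obtain h0 | h1 : finrank k I = 0 ∨ finrank k I = 1 := by omega
  · have : P = 0 := by
      ext v
      have := hP.map_mem v
      rw [Submodule.finrank_eq_zero.mp h0] at this
      simpa using this
    simp [this, h0]
  · obtain ⟨⟨v, hv⟩, hv0, hspan⟩ := finrank_eq_one_iff'.mp h1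
    have hτv : τ v ∈ I := by
      have := congr($hc v)
      simp only [LinearMap.comp_apply, hP.map_id v hv] at this
      rw [this]
      exact hP.map_mem _
    obtain ⟨ε, hε⟩ := hspan ⟨τ v, hτv⟩
    replace hε : ε • v = τ v := congr(($hε : V))
    have hv0' : v ≠ 0 := fun h => hv0 (by simpa using h)
    have hε2 : ε ^ 2 = 1 := by
      have h := congr($hτ v)
      simp only [LinearMap.comp_apply, ← hε, map_smul, LinearMap.id_apply, smul_smul] at h
      have : (ε * ε - 1) • v = 0 := by rw [sub_smul, h, one_smul, sub_self]
      have := (smul_eq_zero.mp this).resolve_right hv0'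
      linear_combination this
    have : τ ∘ₗ P = ε • P := by
      ext w
      obtain ⟨c, hc'⟩ := hspan ⟨P w, hP.map_mem w⟩
      replace hc' : c • v = P w := congr(($hc' : V))
      simp [← hc', ← hε, smul_smul, mul_comm]
    rw [this, map_smul, hP.trace, h1]
    simp [hε2]

namespace Representation

variable {k G V : Type*} [Field k] [Group G] [Fintype G] [Invertible (Fintype.card G : k)]
  [AddCommGroup V] [Module k V] [FiniteDimensional k V]

/-- If `V ⊗ V` has at most a line of invariants, then the square of the Frobenius–Schur indicator
of `V` is the average of `χ²`. -/
theorem frobeniusSchur_sq (ρ : Representation k G V)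
    (h : finrank k (tprod ρ ρ).invariants ≤ 1) :
    ((Fintype.card G : k)⁻¹ * ∑ g : G, ρ.character (g ^ 2)) ^ 2 =
      (Fintype.card G : k)⁻¹ * ∑ g : G, ρ.character g * ρ.character g := by
  have hP := isProj_averageMap (tprod ρ ρ)
  have hP' : averageMap (tprod ρ ρ) = (Fintype.card G : k)⁻¹ • ∑ g : G, tprod ρ ρ g := by
    simp [averageMap, GroupAlgebra.average]
  have key := hP.trace_comp_sq h (_root_.TensorProduct.comm k V V).toLinearMap
    (by ext; simp) (by
      rw [hP']
      ext v w
      simp)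
  have hsum (S : G → V ⊗[k] V →ₗ[k] V ⊗[k] V) :
      (_root_.TensorProduct.comm k V V).toLinearMap ∘ₗ ∑ g, S g =
        ∑ g, (_root_.TensorProduct.comm k V V).toLinearMap ∘ₗ S g := by
    ext; simp
  rw [← hP.trace, hP'] at key
  simp only [LinearMap.comp_smul, hsum, map_smul, map_sum, smul_eq_mul,
    tprod_apply, LinearMap.trace_comm_comp_map, LinearMap.trace_tensorProduct'] at key
  simpa [character, pow_two, Module.End.mul_eq_comp] using key

end Representation

section Completeness

variable {k G : Type} [Field k] [IsAlgClosed k] [CharZero k] [Group G] [Fintype G]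

theorem Representation.IsIrreducible.simple_of {V : Type} [AddCommGroup V] [Module k V]
    [FiniteDimensional k V] (ρ : Representation k G V) [ρ.IsIrreducible] :
    CategoryTheory.Simple (FDRep.of ρ) := by
  have := invertibleOfNonzero (NeZero.ne (Nat.card G : k))
  rw [FDRep.simple_iff_char_is_norm_one]
  have h := Representation.char_orthonormal ρ ρ
  rw [if_pos ⟨.refl _⟩, inv_mul_eq_one₀ (NeZero.ne _)] at h
  exact h.symm

omit [Fintype G] in
/-- A central element of trace zero acts by zero on an irreducible representation. -/
theorem Representation.IsIrreducible.asAlgebraHom_eq_zero {V : Type} [AddCommGroup V] [Module k V]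
    [FiniteDimensional k V] (ρ : Representation k G V) [ρ.IsIrreducible] {z : k[G]}
    (hz : z ∈ Submonoid.center k[G]) (htr : LinearMap.trace k V (ρ.asAlgebraHom z) = 0) :
    ρ.asAlgebraHom z = 0 := by
  obtain ⟨c, hc⟩ := (IsIrreducible.algebraMap_intertwiningMap_bijective_of_isAlgClosed
    (ρ := ρ)).2 (IntertwiningMap.centralAlgebraMul ρ hz)
  have hc' : ρ.asAlgebraHom z = c • LinearMap.id := by
    ext v
    have := congr($hc v)
    simpa [Algebra.algebraMap_eq_smul_one] using this.symm
  have : Nontrivial V := IsSimpleModule.nontrivial k[G] ρ.asModule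
  have hd : (finrank k V : k) ≠ 0 := by simpa using (finrank_pos (R := k) (M := V)).ne'
  rw [hc', map_smul, LinearMap.trace_id, smul_eq_mul] at htr
  rw [hc', (mul_eq_zero.mp htr).resolve_right hd, zero_smul]

omit [IsAlgClosed k] [CharZero k] [Fintype G] in
theorem Representation.asAlgebraHom_ofModule' (M : Type) [AddCommGroup M] [Module k M]
    [Module k[G] M] [IsScalarTower k k[G] M] :
    (ofModule' (k := k) (G := G) M).asAlgebraHom = Algebra.lsmul k k M :=
  (MonoidAlgebra.lift k (M →ₗ[k] M) G).apply_symm_apply _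

omit [IsAlgClosed k] [CharZero k] [Fintype G] in
theorem Representation.isIrreducible_ofModule' (M : Type) [AddCommGroup M] [Module k M]
    [Module k[G] M] [IsScalarTower k k[G] M] [IsSimpleModule k[G] M] :
    (ofModule' (k := k) (G := G) M).IsIrreducible := by
  rw [irreducible_iff_isSimpleModule_asModule]
  let ρ := ofModule' (k := k) (G := G) M
  let e : ρ.asModule ≃ₗ[k[G]] M :=
    { ρ.asModuleEquiv with
      map_smul' := fun r x => by
        have := ρ.asModuleEquiv_map_smul r x
        rw [asAlgebraHom_ofModule'] at this
        exact this }
  exact IsSimpleModule.congr e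

/-- A class function orthogonal to all irreducible characters vanishes. -/
theorem FDRep.eq_zero_of_sum_mul_character_eq_zero (f : G → k)
    (hf : ∀ g h, f (h * g * h⁻¹) = f g)
    (hχ : ∀ W : FDRep k G, CategoryTheory.Simple W → ∑ g, f g * W.character g = 0) :
    f = 0 := by
  let z : k[G] := ∑ g, MonoidAlgebra.single g (f g)
  have hz : z ∈ Submonoid.center k[G] := by
    rw [Submonoid.mem_center_iff]
    intro x
    induction x using MonoidAlgebra.induction_linear with
    | zero => simp
    | add x y hx hy => rw [add_mul, mul_add, hx, hy]
    | single h c =>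
      simp only [z, Finset.mul_sum, Finset.sum_mul, MonoidAlgebra.single_mul_single]
      refine Fintype.sum_equiv (MulAut.conj h).toEquiv _ _ fun g => ?_
      simp [hf, mul_comm]
  have hzero : z ∈ Module.annihilator k[G] k[G] := by
    rw [← Submodule.annihilator_top, ← IsSemisimpleModule.sSup_simples_eq_top, sSup_eq_iSup',
      Submodule.annihilator_iSup, Submodule.mem_iInf]
    rintro ⟨N, hN : IsSimpleModule k[G] N⟩
    have : FiniteDimensional k N := Module.Finite.trans k[G] _
    let ρ := Representation.ofModule' (k := k) (G := G) N
    have : ρ.IsIrreducible := Representation.isIrreducible_ofModule' N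
    have h0 : ρ.asAlgebraHom z = 0 := by
      refine Representation.IsIrreducible.asAlgebraHom_eq_zero ρ hz ?_
      have := hχ (FDRep.of ρ) (Representation.IsIrreducible.simple_of ρ)
      simpa [z, FDRep.character, Representation.asAlgebraHom_single] using this
    rw [Representation.asAlgebraHom_ofModule'] at h0
    exact Module.mem_annihilator.mpr fun n => congr($h0 n)
  have hz0 : z = 0 := by simpa using Module.mem_annihilator.mp hzero 1
  ext g
  classical
  have := congr(($hz0).coeff g)
  simpa [z, Finsupp.finsetSum_apply, Finsupp.single_apply] using this

end Completeness

open scoped Classical in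
/-- For `V` irreducible, `∑ χ(g)²` is `|G|` if the Frobenius–Schur indicator of `V` is nonzero, and
`0` otherwise. -/
theorem FDRep.sum_character_mul_self {k G : Type} [Field k] [IsAlgClosed k] [CharZero k] [Group G] [Fintype G]
    (V : FDRep k G) [CategoryTheory.Simple V] :
    ∑ g : G, V.character g * V.character g =
      if (Fintype.card G : k)⁻¹ * ∑ g : G, V.character (g ^ 2) = 0 then 0
      else (Fintype.card G : k) := by
  have := invertibleOfNonzero (NeZero.ne (Nat.card G : k))
  have := invertibleOfNonzero (NeZero.ne (Fintype.card G : k))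
  have hV := (FDRep.simple_iff_char_is_norm_one V).mp inferInstance
  have hD : CategoryTheory.Simple (FDRep.of (Representation.dual V.ρ)) := by
    rw [FDRep.simple_iff_char_is_norm_one, ← hV]
    simp [mul_comm]
  have h1 := FDRep.char_orthonormal V (FDRep.of (Representation.dual V.ρ))
  simp only [FDRep.char_dual, inv_inv] at h1
  have h2 := Representation.card_inv_mul_sum_char_eq_finrank (Representation.tprod V.ρ V.ρ)
  simp only [Representation.char_tensor, Pi.mul_apply] at h2
  have hle : finrank k (Representation.tprod V.ρ V.ρ).invariants ≤ 1 := by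
    have h3 := h2.symm.trans h1
    split_ifs at h3 <;> norm_cast at h3 <;> omega
  have h4 := Representation.frobeniusSchur_sq V.ρ hle
  change ((Fintype.card G : k)⁻¹ * ∑ g : G, V.character (g ^ 2)) ^ 2 =
      (Fintype.card G : k)⁻¹ * ∑ g : G, V.character g * V.character g at h4
  have hG : (Fintype.card G : k) ≠ 0 := NeZero.ne _
  rw [Nat.card_eq_fintype_card] at h1
  split_ifs at h1 with h0
  · rw [h1] at h4
    rw [if_neg (by rintro h; norm_num [h] at h4)]
    rwa [inv_mul_eq_one₀ hG, eq_comm] at h1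
  · rw [h1] at h4
    rw [if_pos (pow_eq_zero_iff two_ne_zero |>.mp h4)]
    simpa [hG] using h1

open scoped Classical in
/-- Column orthogonality of the irreducible characters of a finite group. -/
theorem FDRep.sum_character_mul_character_inv {k G : Type} [Field k] [IsAlgClosed k] [CharZero k] [Group G]
    [Fintype G]
    {ι : Type} [Fintype ι] (V : ι → FDRep k G)
    (hsimple : ∀ i, CategoryTheory.Simple (V i))
    (hdistinct : ∀ i j : ι, Nonempty (V i ≅ V j) → i = j)
    (hcomplete : ∀ W : FDRep k G, CategoryTheory.Simple W → ∃ i, Nonempty (W ≅ V i)) (g h : G) :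
    ∑ i, (V i).character g * (V i).character h⁻¹ =
      (Finset.univ.filter fun a : G => a * g * a⁻¹ = h).card := by
  have := invertibleOfNonzero (NeZero.ne (Nat.card G : k))
  have hG : (Nat.card G : k) ≠ 0 := NeZero.ne _
  have hortho (i j : ι) : ∑ h : G, (V j).character h * (V i).character h⁻¹ =
      if i = j then (Nat.card G : k) else 0 := by
    have h1 := FDRep.char_orthonormal (V j) (V i)
    rw [inv_mul_eq_iff_eq_mul₀ hG] at h1
    rw [h1]
    by_cases hij : i = j
    · subst hij
      simp [Nonempty.intro (CategoryTheory.Iso.refl (V i))]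
    · rw [if_neg fun hne => hij (hdistinct j i hne).symm, if_neg hij, mul_zero]
  let f : G → k := fun h => ∑ i, (V i).character g * (V i).character h⁻¹ -
    ∑ a : G, if a * g * a⁻¹ = h then 1 else 0
  have hf0 : f = 0 := by
    refine FDRep.eq_zero_of_sum_mul_character_eq_zero f (fun x y => ?_) fun W hW => ?_
    · have hinv (i : ι) : (V i).character (y * x * y⁻¹)⁻¹ = (V i).character x⁻¹ := by
        rw [← FDRep.char_conj (V i) x⁻¹ y]
        congr 1
        group
      simp only [f, hinv]
      congr 1
      refine Fintype.sum_equiv (Equiv.mulLeft y⁻¹) _ _ fun a => ?_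
      congr 1
      simp only [Equiv.coe_mulLeft, eq_iff_iff]
      have hconj : y⁻¹ * a * g * (y⁻¹ * a)⁻¹ = y⁻¹ * (a * g * a⁻¹) * y := by group
      rw [hconj, mul_assoc y⁻¹, inv_mul_eq_iff_eq_mul, eq_mul_inv_iff_mul_eq]
    · obtain ⟨j, ⟨e⟩⟩ := hcomplete W hW
      rw [FDRep.char_iso e]
      simp only [f, sub_mul, Finset.sum_sub_distrib, Finset.sum_mul]
      rw [Finset.sum_comm, Finset.sum_comm (s := Finset.univ (α := G))]
      simp only [ite_mul, one_mul, zero_mul, Finset.sum_ite_eq, Finset.mem_univ, if_true,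
        FDRep.char_conj, Finset.sum_const, nsmul_eq_mul, Finset.card_univ]
      simp only [mul_assoc, ← Finset.mul_sum]
      simp only [mul_comm ((V _).character _⁻¹), hortho]
      simp [mul_comm]
  have := congr($hf0 h)
  simp only [f, Pi.zero_apply, sub_eq_zero] at this
  rw [this, Finset.sum_boole]


/-- The number of pairs `(a, b) ∈ G²` with `a² b² = 1` equals `|G|` times the number of
isomorphism classes of irreducible complex representations of `G` whose
Frobenius–Schur indicator `ν(V) = |G|⁻¹ ∑_g χ_V(g²)` is nonzero (i.e. which are
self-dual). -/
theorem klein_bottle_count (G : Type) [Group G] [Fintype G]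
    (ι : Type) [Fintype ι] (V : ι → FDRep ℂ G)
    (hsimple : ∀ i, CategoryTheory.Simple (V i))
    (hdistinct : ∀ i j : ι, Nonempty (V i ≅ V j) → i = j)
    (hcomplete : ∀ W : FDRep ℂ G, CategoryTheory.Simple W → ∃ i, Nonempty (W ≅ V i))
    (ν : ι → ℂ)
    (hν : ∀ i, ν i = (Fintype.card G : ℂ)⁻¹ * ∑ g : G, (V i).character (g ^ 2)) :
    Nat.card {p : G × G // p.1 ^ 2 * p.2 ^ 2 = 1} =
      Fintype.card G * Nat.card {i : ι // ν i ≠ 0} := by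
  classical
  let e : {p : G × G // p.1 ^ 2 * p.2 ^ 2 = 1} ≃
      Σ c : G, {a : G // a * c * a⁻¹ = c⁻¹} :=
    { toFun := fun p => ⟨p.1.1 * p.1.2, p.1.1, by
        rw [eq_inv_iff_mul_eq_one]
        refine Eq.trans ?_ p.2
        simp only [pow_two]
        group⟩
      invFun := fun s => ⟨(s.2.1, s.2.1⁻¹ * s.1), by
        refine Eq.trans ?_ (eq_inv_iff_mul_eq_one.mp s.2.2)
        simp only [pow_two]
        group⟩
      left_inv := fun p => by ext <;> simp
      right_inv := fun s => Sigma.subtype_ext (by simp) rfl }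
  have hcount : (Nat.card {p : G × G // p.1 ^ 2 * p.2 ^ 2 = 1} : ℂ) =
      ∑ c : G, ∑ i, (V i).character c * (V i).character c := by
    rw [Nat.card_congr e, Nat.card_eq_fintype_card, Fintype.card_sigma, Nat.cast_sum]
    refine Finset.sum_congr rfl fun c _ => ?_
    have := FDRep.sum_character_mul_character_inv V hsimple hdistinct hcomplete c c⁻¹
    rw [inv_inv] at this
    rw [this, Fintype.card_subtype]
  rw [Finset.sum_comm] at hcount
  simp only [FDRep.sum_character_mul_self, ← hν] at hcount
  rw [← Nat.cast_inj (R := ℂ), hcount, Nat.card_eq_fintype_card, Fintype.card_subtype, Nat.cast_mul,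
    Finset.card_filter]
  push_cast
  rw [Finset.mul_sum]
  exact Finset.sum_congr rfl fun i _ => by by_cases h : ν i = 0 <;> simp [h]
end

section
/- Let G be a finite group and V an irreducible complex representation of G with ν(V) = -1. Then the dimension of V is even. -/
open CategoryTheory Module Matrix

namespace FDRep

theorem subrepresentation_eq_bot_or_eq_top {k G : Type*} [Field k] [Monoid G] (V : FDRep k G)
    [Simple V] (S : Subrepresentation V.ρ) : S.toSubmodule = ⊥ ∨ S.toSubmodule = ⊤ := by
  let W : FDRep k G := FDRep.of S.toRepresentation
  let i : W ⟶ V := ⟨InducedCategory.homMk (ModuleCat.ofHom S.toSubmodule.subtype), fun g => by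
    ext; rfl⟩
  have hi : ∀ x : S.toSubmodule, i.hom x = (x : V) := fun _ => rfl
  have : Mono i := ConcreteCategory.mono_of_injective i Subtype.val_injective
  by_cases h : i = 0
  · left
    rw [Submodule.eq_bot_iff]
    intro x hx
    have := hi ⟨x, hx⟩
    rw [h] at this
    exact this.symm
  · right
    have : IsIso i := isIso_of_mono_of_nonzero h
    rw [Submodule.eq_top_iff']
    intro x
    have hx : i.hom ((inv i).hom x) = x := by
      have h1 : (inv i ≫ i).hom x = x := by rw [IsIso.inv_hom_id]; rfl
      exact h1
    rw [← hx]
    exact Subtype.property (p := (· ∈ S.toSubmodule)) ((inv i).hom x)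

end FDRep

theorem Matrix.even_card_of_transpose_eq_neg {n K : Type*} [Fintype n] [DecidableEq n]
    [Field K] [CharZero K] {M : Matrix n n K} (hM : Mᵀ = -M) (hdet : M.det ≠ 0) :
    Even (Fintype.card n) := by
  by_contra hodd
  have h := M.det_transpose
  rw [hM, det_neg, (Nat.not_even_iff_odd.mp hodd).neg_one_pow, neg_one_mul] at h
  exact hdet (self_eq_neg.mp h.symm)

namespace Representation

variable {k G V ι : Type*} [Field k] [Group G] [Fintype G] [AddCommGroup V] [Module k V]
  [Fintype ι] [DecidableEq ι]

/-- The sum over the group of the translates of a bilinear form on the dual, in coordinates. -/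
noncomputable def orbitSum (ρ : Representation k G V) (b : Basis ι k V) (X : Matrix ι ι k) :
    Matrix ι ι k :=
  ∑ g, LinearMap.toMatrix b b (ρ g) * X * (LinearMap.toMatrix b b (ρ g))ᵀ

variable (ρ : Representation k G V) (b : Basis ι k V)

theorem toMatrix_mul_orbitSum (X : Matrix ι ι k) (h : G) :
    LinearMap.toMatrix b b (ρ h) * ρ.orbitSum b X =
      ρ.orbitSum b X * (LinearMap.toMatrix b b (ρ h⁻¹))ᵀ := by
  rw [orbitSum, Finset.mul_sum, Finset.sum_mul]
  refine Fintype.sum_equiv (Equiv.mulLeft h) _ _ fun g => ?_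
  have hg : LinearMap.toMatrix b b (ρ g) =
      LinearMap.toMatrix b b (ρ h⁻¹) * LinearMap.toMatrix b b (ρ (h * g)) := by
    rw [← LinearMap.toMatrix_mul, ← map_mul, inv_mul_cancel_left]
  have hg' : LinearMap.toMatrix b b (ρ (h * g)) =
      LinearMap.toMatrix b b (ρ h) * LinearMap.toMatrix b b (ρ g) := by
    rw [← LinearMap.toMatrix_mul, ← map_mul]
  rw [Equiv.coe_mulLeft, Matrix.mul_assoc _ _ (LinearMap.toMatrix b b (ρ h⁻¹))ᵀ,
    ← Matrix.transpose_mul, ← hg, hg']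
  simp only [Matrix.mul_assoc]

/-- The range of an orbit sum, as a subrepresentation. -/
noncomputable def orbitSumRange (X : Matrix ι ι k) : Subrepresentation ρ where
  toSubmodule := LinearMap.range (Matrix.toLin b b (ρ.orbitSum b X))
  apply_mem_toSubmodule h := by
    rintro _ ⟨w, rfl⟩
    refine ⟨Matrix.toLin b b (LinearMap.toMatrix b b (ρ h⁻¹))ᵀ w, ?_⟩
    rw [← LinearMap.comp_apply, ← Matrix.toLin_mul, ← toMatrix_mul_orbitSum,
      Matrix.toLin_mul b b b, Matrix.toLin_toMatrix, LinearMap.comp_apply]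

theorem orbitSum_eq_zero_or_det_ne_zero
    (hρ : ∀ S : Subrepresentation ρ, S.toSubmodule = ⊥ ∨ S.toSubmodule = ⊤) (X : Matrix ι ι k) :
    ρ.orbitSum b X = 0 ∨ (ρ.orbitSum b X).det ≠ 0 := by
  rcases hρ (ρ.orbitSumRange b X) with h | h
  · left
    exact (Matrix.toLin b b).map_eq_zero_iff.mp (LinearMap.range_eq_bot.mp h)
  · right
    have : FiniteDimensional k V := b.finiteDimensional_of_finite
    have hs : Function.Surjective (Matrix.toLin b b (ρ.orbitSum b X)) :=
      LinearMap.range_eq_top.mp h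
    have hu := (Module.End.isUnit_iff _).mpr ⟨LinearMap.injective_iff_surjective.mpr hs, hs⟩
    rw [← LinearMap.det_toLin b]
    exact ((LinearMap.isUnit_iff_isUnit_det _).mp hu).ne_zero

theorem orbitSum_transpose (X : Matrix ι ι k) :
    (ρ.orbitSum b X)ᵀ = ρ.orbitSum b Xᵀ := by
  simp [orbitSum, Matrix.transpose_sum, Matrix.mul_assoc]

theorem orbitSum_sub (X Y : Matrix ι ι k) :
    ρ.orbitSum b (X - Y) = ρ.orbitSum b X - ρ.orbitSum b Y := by
  simp [orbitSum, Matrix.mul_sub, Matrix.sub_mul]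

theorem orbitSum_single_apply (i j l m : ι) :
    ρ.orbitSum b (Matrix.single i j 1) l m =
      ∑ g, LinearMap.toMatrix b b (ρ g) l i * LinearMap.toMatrix b b (ρ g) m j := by
  rw [orbitSum, Matrix.sum_apply]
  refine Finset.sum_congr rfl fun g _ => ?_
  rw [Matrix.mul_apply, Finset.sum_eq_single j]
  · simp
  · intro x _ hx
    rw [Matrix.mul_single_apply_of_ne (hbj := hx), zero_mul]
  · simp

theorem sum_orbitSum_single :
    ∑ i, ∑ j, ρ.orbitSum b (Matrix.single i j 1) i j = ∑ g, ρ.character g ^ 2 := by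
  simp_rw [orbitSum_single_apply]
  rw [Finset.sum_congr rfl fun i _ => Finset.sum_comm, Finset.sum_comm]
  refine Finset.sum_congr rfl fun g _ => ?_
  rw [character, LinearMap.trace_eq_matrix_trace k b, sq, Matrix.trace, Finset.sum_mul_sum]
  rfl

theorem sum_orbitSum_single_swap :
    ∑ i, ∑ j, ρ.orbitSum b (Matrix.single j i 1) i j = ∑ g, ρ.character (g ^ 2) := by
  simp_rw [orbitSum_single_apply]
  rw [Finset.sum_congr rfl fun i _ => Finset.sum_comm, Finset.sum_comm]
  refine Finset.sum_congr rfl fun g _ => ?_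
  rw [character, LinearMap.trace_eq_matrix_trace k b, sq, map_mul, LinearMap.toMatrix_mul,
    Matrix.trace]
  simp [Matrix.mul_apply]

theorem even_finrank_or_sum_char_sq [CharZero k] [FiniteDimensional k V]
    (hρ : ∀ S : Subrepresentation ρ, S.toSubmodule = ⊥ ∨ S.toSubmodule = ⊤) :
    Even (finrank k V) ∨ ∑ g, ρ.character (g ^ 2) = ∑ g, ρ.character g ^ 2 := by
  let b := finBasis k V
  by_cases hswap : ∀ i j,
      ρ.orbitSum b (Matrix.single i j 1) = ρ.orbitSum b (Matrix.single j i 1)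
  · right
    rw [← sum_orbitSum_single ρ b, ← sum_orbitSum_single_swap ρ b]
    exact Finset.sum_congr rfl fun i _ => Finset.sum_congr rfl fun j _ => by rw [hswap]
  · left
    push Not at hswap
    obtain ⟨i, j, hij⟩ := hswap
    have hdet := (ρ.orbitSum_eq_zero_or_det_ne_zero b hρ
      (Matrix.single i j 1 - Matrix.single j i 1)).resolve_left
        (by rwa [orbitSum_sub, sub_eq_zero])
    have h := Matrix.even_card_of_transpose_eq_neg
      (by simp [orbitSum_transpose, orbitSum_sub]) hdet
    rwa [Fintype.card_fin] at h

end Representation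


/-- An irreducible complex representation of a finite group whose Frobenius–Schur
indicator `ν(V) = |G|⁻¹ ∑_g χ_V(g²)` equals `-1` has even dimension. -/
theorem even_dim_of_fs_indicator_neg_one (G : Type) [Group G] [Fintype G]
    (V : FDRep ℂ G) (hsimple : CategoryTheory.Simple V)
    (hν : (Fintype.card G : ℂ)⁻¹ * ∑ g : G, V.character (g ^ 2) = -1) :
    Even (Module.finrank ℂ V) := by
  refine (Representation.even_finrank_or_sum_char_sq V.ρ
    V.subrepresentation_eq_bot_or_eq_top).resolve_right fun h => ?_
  have : Invertible (Nat.card G : ℂ) := invertibleOfNonzero (by simp)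
  have hdim := Representation.card_inv_mul_sum_char_eq_finrank (Representation.tprod V.ρ V.ρ)
  change _ * ∑ g : G, Representation.character V.ρ (g ^ 2) = _ at hν
  rw [h, ← Nat.card_eq_fintype_card] at hν
  simp only [Representation.char_tensor, Pi.mul_apply, ← sq] at hdim
  rw [hν] at hdim
  have := congrArg Complex.re hdim
  simp only [Complex.neg_re, Complex.one_re, Complex.natCast_re] at this
  linarith [Nat.cast_nonneg (α := ℝ)
    (finrank ℂ (Representation.invariants (Representation.tprod V.ρ V.ρ)))]
end

section
/- Let G be a finite group and V an irreducible complex representation of G that is isomorphic to its dual representation V*. Then there exists a nondegenerate G-invariant bilinear form B on V (i.e. B(g·v, g·w) = B(v, w) for all g ∈ G and v, w ∈ V); moreover B is symmetric if and only if ν(V) = 1, and B is alternating if and only if ν(V) = -1. -/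
open CategoryTheory in
/-- **Schur's lemma** for `FDRep`, phrased in terms of linear endomorphisms. -/
theorem FDRep.exists_eq_smul_id_of_commute {k : Type} [Field k] [IsAlgClosed k] {G : Type}
    [Group G] (V : FDRep k G) [Simple V] (f : V →ₗ[k] V)
    (hf : ∀ g v, f (V.ρ g v) = V.ρ g (f v)) : ∃ t : k, ∀ v, f v = t • v := by
  let φ : V ⟶ V := ⟨InducedCategory.homMk (ModuleCat.ofHom f), fun g ↦ by
    ext v
    exact hf g v⟩
  obtain ⟨t, ht⟩ := endomorphism_simple_eq_smul_id k φ
  refine ⟨t, fun v ↦ ?_⟩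
  have h := congrArg (fun ψ : V ⟶ V ↦ ψ.hom.hom.hom v) ht
  exact h.symm

namespace Representation

variable {k G V : Type*} [Field k] [Group G] [AddCommGroup V] [Module k V]

/-- If every endomorphism of `ρ` is a scalar and the nondegenerate form `e` is invariant, then
every invariant form is a multiple of `e`. -/
theorem exists_eq_smul_of_invariant {ρ : Representation k G V}
    (schur : ∀ f : V →ₗ[k] V, (∀ g v, f (ρ g v) = ρ g (f v)) → ∃ t : k, ∀ v, f v = t • v)
    (e : V ≃ₗ[k] Module.Dual k V) (he : ∀ g v w, e (ρ g v) (ρ g w) = e v w)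
    (F : V →ₗ[k] V →ₗ[k] k) (hF : ∀ g v w, F (ρ g v) (ρ g w) = F v w) :
    ∃ t : k, ∀ v w, F v w = t * e v w := by
  obtain ⟨t, ht⟩ := schur (e.symm.toLinearMap ∘ₗ F) fun g v ↦ e.injective <| by
    ext w
    have h₁ := hF g v (ρ g⁻¹ w)
    have h₂ := he g (e.symm (F v)) (ρ g⁻¹ w)
    rw [self_inv_apply] at h₁ h₂
    simp [h₁, h₂]
  refine ⟨t, fun v w ↦ ?_⟩
  have h := congrArg (fun x ↦ e x w) (ht v)
  simpa using h

/-- If the invariant bilinear forms are the multiples of a nonzero form `B` whose transpose is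
`c • B`, then the Frobenius–Schur sum of `ρ` is `c * |G|`. -/
theorem sum_trace_sq_eq_mul_card [Fintype G] [FiniteDimensional k V]
    {ρ : Representation k G V} (B : V →ₗ[k] V →ₗ[k] k)
    (hB : ∀ g v w, B (ρ g v) (ρ g w) = B v w)
    (huniq : ∀ F : V →ₗ[k] V →ₗ[k] k, (∀ g v w, F (ρ g v) (ρ g w) = F v w) →
      ∃ t : k, ∀ v w, F v w = t * B v w)
    {v₀ w₀ : V} (h₀ : B v₀ w₀ ≠ 0) {c : k} (hc : ∀ v w, B w v = c * B v w) :
    ∑ g : G, LinearMap.trace k V (ρ (g ^ 2)) = c * Fintype.card G := by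
  let b := Module.finBasis k V
  have key (i j) : ∃ t : k, ∀ v w,
      ∑ g : G, b.coord i (ρ g v) * b.coord j (ρ g w) = t * B v w := by
    let F : V →ₗ[k] V →ₗ[k] k :=
      ∑ g : G, (LinearMap.mul k k).compl₁₂ (b.coord i ∘ₗ ρ g) (b.coord j ∘ₗ ρ g)
    have hF (v w) : F v w = ∑ g : G, b.coord i (ρ g v) * b.coord j (ρ g w) := by
      simp [F, LinearMap.sum_apply]
    simp_rw [← hF]
    refine huniq F fun g v w ↦ ?_
    simp_rw [hF, ← Module.End.mul_apply, ← map_mul]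
    exact (Group.mulRight_bijective g).sum_comp
      fun x ↦ b.coord i (ρ x v) * b.coord j (ρ x w)
  choose φ hφ using key
  have hexpand (v w : V) :
      B v w = ∑ i, ∑ j, b.coord i v * b.coord j w * B (b i) (b j) := by
    conv_lhs => rw [← b.sum_repr v, ← b.sum_repr w]
    simp only [map_sum, map_smul, LinearMap.sum_apply, LinearMap.smul_apply, smul_eq_mul,
      Module.Basis.coord_apply, Finset.mul_sum]
    rw [Finset.sum_comm]
    exact Finset.sum_congr rfl fun i _ ↦ Finset.sum_congr rfl fun j _ ↦ by ring
  have hcard : ∑ i, ∑ j, φ i j * B (b i) (b j) = Fintype.card G := by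
    refine mul_right_cancel₀ h₀ ?_
    calc (∑ i, ∑ j, φ i j * B (b i) (b j)) * B v₀ w₀
        = ∑ i, ∑ j, (∑ g : G, b.coord i (ρ g v₀) * b.coord j (ρ g w₀)) * B (b i) (b j) := by
          simp_rw [hφ, Finset.sum_mul, mul_right_comm]
      _ = ∑ g : G, B (ρ g v₀) (ρ g w₀) := by
          simp_rw [hexpand (ρ _ v₀), Finset.sum_mul]
          rw [Finset.sum_comm (s := (Finset.univ : Finset G))]
          refine Finset.sum_congr rfl fun i _ ↦ ?_
          rw [Finset.sum_comm]
      _ = Fintype.card G * B v₀ w₀ := by simp [hB]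
  calc ∑ g : G, LinearMap.trace k V (ρ (g ^ 2))
      = ∑ g : G, ∑ i, ∑ j, b.coord i (ρ g (b j)) * b.coord j (ρ g (b i)) := by
        simp [LinearMap.trace_eq_matrix_trace k b, pow_two, LinearMap.toMatrix_mul, Matrix.trace,
          Matrix.mul_apply, LinearMap.toMatrix_apply]
    _ = ∑ i, ∑ j, φ i j * B (b j) (b i) := by
        rw [Finset.sum_comm]
        refine Finset.sum_congr rfl fun i _ ↦ ?_
        rw [Finset.sum_comm]
        exact Finset.sum_congr rfl fun j _ ↦ hφ i j _ _
    _ = c * Fintype.card G := by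
        simp_rw [← hcard, Finset.mul_sum]
        exact Finset.sum_congr rfl fun i _ ↦ Finset.sum_congr rfl fun j _ ↦ by
          rw [hc (b i) (b j), mul_left_comm]

end Representation

/-- A self-dual irreducible complex representation `V` of a finite group `G` carries a
nondegenerate `G`-invariant bilinear form `B`; moreover `B` is symmetric iff the
Frobenius–Schur indicator `ν(V) = |G|⁻¹ ∑_g χ_V(g²)` equals `1`, and `B` is
alternating iff `ν(V) = -1`. -/
theorem exists_invariant_bilinear_form (G : Type) [Group G] [Fintype G]
    (V : FDRep ℂ G) (hsimple : CategoryTheory.Simple V)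
    (hself : Nonempty (V ≅ FDRep.of (Representation.dual V.ρ)))
    (ν : ℂ) (hν : ν = (Fintype.card G : ℂ)⁻¹ * ∑ g : G, V.character (g ^ 2)) :
    ∃ B : V →ₗ[ℂ] V →ₗ[ℂ] ℂ,
      (∀ v : V, (∀ w : V, B v w = 0) → v = 0) ∧
      (∀ (g : G) (v w : V), B (V.ρ g v) (V.ρ g w) = B v w) ∧
      ((∀ v w : V, B v w = B w v) ↔ ν = 1) ∧
      ((∀ v : V, B v v = 0) ↔ ν = -1) := by
  obtain ⟨i⟩ := hself
  let e : V ≃ₗ[ℂ] Module.Dual ℂ V := FDRep.isoToLinearEquiv i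
  have he (g : G) (v w : V) : e (V.ρ g v) (V.ρ g w) = e v w := by
    have h : Representation.dual V.ρ g (e v) = e (V.ρ g (e.symm (e v))) :=
      LinearMap.congr_fun (FDRep.Iso.conj_ρ i g) (e v)
    rw [e.symm_apply_apply] at h
    rw [← h, Representation.dual_apply, Module.Dual.transpose_apply, LinearMap.comp_apply,
      Representation.inv_self_apply]
  have hnondeg (v : V) (hv : ∀ w, e v w = 0) : v = 0 :=
    e.map_eq_zero_iff.mp (LinearMap.ext hv)
  have huniq := Representation.exists_eq_smul_of_invariant (ρ := V.ρ)
    V.exists_eq_smul_id_of_commute e he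
  obtain ⟨v₀, w₀, h₀⟩ : ∃ v w : V, e v w ≠ 0 := by
    by_contra! h
    refine CategoryTheory.id_nonzero V ?_
    ext v
    exact hnondeg v (h v)
  obtain ⟨c, hc⟩ := huniq e.toLinearMap.flip fun g v w ↦ he g w v
  replace hc (v w : V) : e w v = c * e v w := hc v w
  have hνc : ν = c := by
    rw [hν]
    have h := Representation.sum_trace_sq_eq_mul_card (ρ := V.ρ) e.toLinearMap he huniq h₀ hc
    have hG : (Fintype.card G : ℂ) ≠ 0 := Nat.cast_ne_zero.mpr Fintype.card_ne_zero
    rw [show ∑ g : G, V.character (g ^ 2) = c * Fintype.card G from h]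
    field_simp
  refine ⟨e.toLinearMap, hnondeg, he, ⟨fun h ↦ ?_, fun h v w ↦ ?_⟩,
    ⟨fun h ↦ ?_, fun h v ↦ ?_⟩⟩
  · have h₁ : e v₀ w₀ = e w₀ v₀ := h v₀ w₀
    rw [hc v₀ w₀] at h₁
    rw [hνc]
    exact mul_right_cancel₀ h₀ (by rw [one_mul, ← h₁])
  · have h₁ := hc w v
    rwa [← hνc, h, one_mul] at h₁
  · have h₁ : e (v₀ + w₀) (v₀ + w₀) = 0 := h _
    have h₂ : e v₀ v₀ = 0 := h _
    have h₃ : e w₀ w₀ = 0 := h _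
    simp only [map_add, LinearMap.add_apply, h₂, h₃, hc v₀ w₀] at h₁
    rw [hνc]
    exact mul_right_cancel₀ h₀ (by linear_combination h₁)
  · have h₁ := hc v v
    rw [← hνc, h] at h₁
    exact self_eq_neg.mp (by simpa using h₁)
end
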